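/- arXiv:2308.13635 — 3 statements merged into one kernel-verified Lean document; each statement's English description precedes it below -/
import Mathlib

section
/- Let Γ be a finite group and p a prime such that the first group cohomology H¹(Γ; F_p) with coefficients in the trivial module F_p is nonzero. Then the second group cohomology H²(Γ; F_p) with coefficients in the trivial module F_p is also nonzero. -/
open groupCohomology

/-- If `H²(Γ; F_p)` vanishes, a map `φ : Γ → ℤ` that is additive modulo `n` can be corrected by
a multiple of `n` to a map that is additive modulo `n * p`. -/
theorem exists_lift_of_subsingleton_H2 {p : ℕ} [Fact p.Prime] {Γ : Type} [Group Γ]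
    [Subsingleton (H2 (Rep.trivial (ZMod p) Γ (ZMod p)))] {n : ℤ} (hn : n ≠ 0)
    {φ : Γ → ℤ} (hφ : ∀ g h, n ∣ φ g + φ h - φ (g * h)) :
    ∃ ψ : Γ → ℤ, (∀ g h, n * p ∣ ψ g + ψ h - ψ (g * h)) ∧ ∀ g, n ∣ ψ g - φ g := by
  choose c hc using hφ
  have hc' (g h j : Γ) : c (g * h) j + c g h = c h j + c g (h * j) := by
    apply mul_left_cancel₀ hn
    rw [mul_add, mul_add, ← hc, ← hc, ← hc, ← hc, mul_assoc]
    ring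
  have hmem : (fun x : Γ × Γ => (c x.1 x.2 : ZMod p)) ∈
      cocycles₂ (Rep.trivial (ZMod p) Γ (ZMod p)) := by
    rw [mem_cocycles₂_iff]
    intro g h j
    have key := congrArg (Int.cast : ℤ → ZMod p) (hc' g h j)
    push_cast at key
    exact key
  obtain ⟨b, hb⟩ := (H2π_eq_zero_iff ⟨_, hmem⟩).1 (Subsingleton.elim _ _)
  have hb' (g h : Γ) : (b h : ZMod p) - b (g * h) + b g = (c g h : ZMod p) := congrFun hb (g, h)
  choose B hB using fun g => ZMod.intCast_surjective (b g : ZMod p)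
  refine ⟨fun g => φ g - n * B g, fun g h => ?_, fun g => ⟨-B g, by ring⟩⟩
  have hdvd : (p : ℤ) ∣ c g h - (B h - B (g * h) + B g) := by
    rw [← ZMod.intCast_zmod_eq_zero_iff_dvd]
    push_cast
    rw [hB, hB, hB, hb', sub_self]
  have heq : φ g - n * B g + (φ h - n * B h) - (φ (g * h) - n * B (g * h)) =
      n * (c g h - (B h - B (g * h) + B g)) := by
    rw [mul_sub, ← hc]
    ring
  rw [heq]
  exact mul_dvd_mul_left n hdvd

/-- A map to `ℤ` that is additive modulo `n` takes powers to multiples modulo `n`. -/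
theorem dvd_map_pow_sub_mul {Γ : Type*} [Group Γ] {n : ℤ} {φ : Γ → ℤ}
    (hφ : ∀ g h, n ∣ φ g + φ h - φ (g * h)) (g : Γ) (m : ℕ) : n ∣ φ (g ^ m) - m * φ g := by
  induction m with
  | zero => simpa using hφ 1 1
  | succ m ih =>
    have heq : φ (g ^ (m + 1)) - (m + 1 : ℕ) * φ g =
        φ (g ^ m) - m * φ g - (φ (g ^ m) + φ g - φ (g ^ m * g)) := by
      rw [pow_succ]
      push_cast
      ring
    rw [heq]
    exact dvd_sub ih (hφ (g ^ m) g)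

/-- A map from a finite group to `ℤ` that is additive modulo `n` has values killed by the order
of the group modulo `n`. -/
theorem dvd_card_mul_map {Γ : Type*} [Group Γ] {n : ℤ} {φ : Γ → ℤ}
    (hφ : ∀ g h, n ∣ φ g + φ h - φ (g * h)) (g : Γ) : n ∣ Nat.card Γ * φ g := by
  have h1 : n ∣ φ 1 := by simpa using hφ 1 1
  have h2 := dvd_map_pow_sub_mul hφ g (Nat.card Γ)
  rw [pow_card_eq_one'] at h2
  simpa using dvd_sub h1 h2

/-- For a finite group `Γ` and a prime `p`, if the first group cohomology
`H¹(Γ; F_p)` with coefficients in the trivial representation `F_p` is nonzero,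
then so is the second group cohomology `H²(Γ; F_p)`. -/
theorem H2_nontrivial_of_H1_nontrivial (p : ℕ) [Fact p.Prime] (Γ : Type) [Group Γ]
    [Finite Γ]
    (h1 : Nontrivial (groupCohomology (Rep.trivial (ZMod p) Γ (ZMod p)) 1)) :
    Nontrivial (groupCohomology (Rep.trivial (ZMod p) Γ (ZMod p)) 2) := by
  by_contra h2
  rw [not_nontrivial_iff_subsingleton] at h2
  have hp : p.Prime := Fact.out
  obtain ⟨x, hx⟩ := exists_ne (0 : H1 (Rep.trivial (ZMod p) Γ (ZMod p)))
  induction x using H1_induction_on with | h f =>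
  obtain ⟨g, hg⟩ : ∃ g, f g ≠ 0 := by
    by_contra! hf
    exact hx (by rw [show f = 0 from cocycles₁_ext hf, map_zero])
  have lift (k : ℕ) : ∃ φ : Γ → ℤ,
      (∀ a b, (p : ℤ) ^ (k + 1) ∣ φ a + φ b - φ (a * b)) ∧ ¬ (p : ℤ) ∣ φ g := by
    induction k with
    | zero =>
      choose φ hφ using fun a => ZMod.intCast_surjective (f a : ZMod p)
      refine ⟨φ, fun a b => ?_, fun h => hg ?_⟩
      · rw [zero_add, pow_one, ← ZMod.intCast_zmod_eq_zero_iff_dvd]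
        push_cast
        rw [hφ, hφ, hφ, sub_eq_zero]
        exact (cocycles₁_map_mul_of_isTrivial f a b).symm
      · rw [← ZMod.intCast_zmod_eq_zero_iff_dvd, hφ] at h
        exact h
    | succ k ih =>
      obtain ⟨φ, hφ, hφg⟩ := ih
      obtain ⟨ψ, hψ, hψφ⟩ := exists_lift_of_subsingleton_H2 (p := p)
        (pow_ne_zero _ (by exact_mod_cast hp.ne_zero)) hφ
      refine ⟨ψ, hψ, fun h => hφg ?_⟩
      exact (dvd_sub_right h).1 ((dvd_pow_self _ k.succ_ne_zero).trans (hψφ g))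
  obtain ⟨φ, hφ, hφg⟩ := lift (Nat.card Γ)
  have hcop : IsCoprime ((p : ℤ) ^ (Nat.card Γ + 1)) (φ g) :=
    (((Nat.prime_iff_prime_int.1 hp).coprime_iff_not_dvd).2 hφg).pow_left
  have hdvd : p ^ (Nat.card Γ + 1) ∣ Nat.card Γ := by
    exact_mod_cast hcop.dvd_of_dvd_mul_right (dvd_card_mul_map hφ g)
  have hle := Nat.le_of_dvd Nat.card_pos hdvd
  have hlt := Nat.lt_pow_self hp.one_lt (n := Nat.card Γ + 1)
  omega
end

section
/- Let A be a commutative Noetherian ring and let S and T be any two sets. Then the natural A-linear map (S → A) ⊗_A (T → A) → (S × T → A), determined by sending f ⊗ g to the function (s,t) ↦ f(s)·g(t), is injective. -/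
/-- The natural `A`-bilinear map `(S → A) → (T → A) → (S × T → A)` sending
`(f, g)` to the function `(s, t) ↦ f(s)·g(t)`. -/
def funMulBil (A : Type*) [CommRing A] (S T : Type*) :
    (S → A) →ₗ[A] (T → A) →ₗ[A] (S × T → A) :=
  LinearMap.mk₂ A (fun f g st => f st.1 * g st.2)
    (fun f f' g => by funext st; simp [add_mul])
    (fun c f g => by funext st; simp [smul_eq_mul, mul_assoc])
    (fun f g g' => by funext st; simp [mul_add])
    (fun c f g => by funext st; simp [smul_eq_mul]; ring)

/-- For a commutative Noetherian ring `A` and any sets `S`, `T`, the natural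
`A`-linear map `(S → A) ⊗_A (T → A) → (S × T → A)` determined by
`f ⊗ g ↦ ((s,t) ↦ f(s)·g(t))` is injective. -/
theorem tensor_of_pi_injective (A : Type*) [CommRing A] [IsNoetherianRing A]
    (S T : Type*) :
    Function.Injective (TensorProduct.lift (funMulBil A S T)) := by
  rw [injective_iff_map_eq_zero]
  intro x hx
  obtain ⟨n, f, g, rfl⟩ := TensorProduct.exists_sum_tmul_eq x
  have h (s : S) (t : T) : ∑ i, f i s * g i t = 0 := by
    simpa [funMulBil] using congrFun hx (s, t)
  -- The relations between the `f i` form a finitely generated module.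
  let K : Submodule A (Fin n → A) := LinearMap.ker (Fintype.linearCombination A f)
  obtain ⟨m, k, hk⟩ := Submodule.fg_iff_exists_fin_generating_family.mp
    (IsNoetherian.noetherian K)
  have hg (t : T) : ∃ c : Fin m → A, ∑ j, c j • k j = fun i => g i t := by
    rw [← Submodule.mem_span_range_iff_exists_fun, hk, LinearMap.mem_ker]
    funext s
    simpa [Fintype.linearCombination_apply, mul_comm] using h s t
  choose c hc using hg
  apply TensorProduct.sum_tmul_eq_zero_of_vanishesTrivially
  refine ⟨m, fun i j => k j i, fun j t => c t j, fun i => ?_, fun j => ?_⟩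
  · funext t
    simpa [mul_comm] using (congrFun (hc t) i).symm
  · have hj : k j ∈ K := hk ▸ Submodule.subset_span (Set.mem_range_self j)
    simpa [K, Fintype.linearCombination_apply] using hj
end

section
/- Let A be a commutative ring, S a set, and α₁,…,α_r : S → A (r ≥ 1). If two words u and v in the alphabet S represent the same element of the free group F_S, then their letter-braiding numbers agree: ℓ_{α₁|…|α_r}(u) = ℓ_{α₁|…|α_r}(v). In particular, ℓ_{α₁|…|α_r} is a well-defined function on F_S. -/
open scoped BigOperators

/-- Signed evaluation of `α : S → A` on a letter `(s, ε)`. -/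
def sev {A : Type*} [CommRing A] {S : Type*} (α : S → A) (l : S × Bool) : A :=
  if l.2 then α l.1 else - α l.1

/-- The relation `i <_w j` on positions of the word `w`: `i < j` if the `i`-th
letter is positive, and `i ≤ j` if it is negative. -/
def ltw {S : Type*} (w : List (S × Bool)) (p q : Fin w.length) : Bool :=
  if (w.get p).2 then decide ((p : ℕ) < (q : ℕ)) else decide ((p : ℕ) ≤ (q : ℕ))

/-- Letter-braiding number of a word `w` with respect to a list of functions
`α₁,…,α_r : S → A`: the sum over all sequences of positions
`i₁ <_w i₂ <_w ⋯ <_w i_r` of the products `∏_j α_j(s_{i_j}, ε_{i_j})`.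
For `r = 0` it equals `1`. -/
def lbnWord (A : Type*) [CommRing A] {S : Type*} (w : List (S × Bool))
    (αs : List (S → A)) : A :=
  ∑ i ∈ Finset.univ.filter
      (fun i : Fin αs.length → Fin w.length =>
        ∀ a b : Fin αs.length, (a : ℕ) + 1 = (b : ℕ) → ltw w (i a) (i b) = true),
    ∏ j : Fin αs.length, sev (αs.get j) (w.get (i j))

/-- Letter-braiding number of an element of the free group, computed from its
reduced word. -/
def lbn (A : Type*) [CommRing A] {S : Type*} [DecidableEq S] (g : FreeGroup S)
    (αs : List (S → A)) : A :=
  lbnWord A g.toWord αs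

/-- The sum of `∏_j α_j(w_{i_j})` over the sequences `i₁ <_w ⋯ <_w i_r` whose first position
satisfies `P`, computed by recursion on the list of functions. -/
def chainSum {A : Type*} [CommRing A] {S : Type*} (w : List (S × Bool)) :
    List (S → A) → (Fin w.length → Bool) → A
  | [], _ => 1
  | α :: αs, P => ∑ i, if P i then sev α (w.get i) * chainSum w αs (ltw w i) else 0

theorem chainSum_eq_sum_filter {A : Type*} [CommRing A] {S : Type*} (w : List (S × Bool))
    (αs : List (S → A)) (P : Fin w.length → Bool) :
    chainSum w αs P = ∑ i ∈ Finset.univ.filter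
      (fun i : Fin αs.length → Fin w.length =>
        (∀ a b : Fin αs.length, (a : ℕ) + 1 = (b : ℕ) → ltw w (i a) (i b) = true) ∧
          ∀ a : Fin αs.length, (a : ℕ) = 0 → P (i a) = true),
      ∏ j : Fin αs.length, sev (αs.get j) (w.get (i j)) := by
  induction αs generalizing P with
  | nil =>
    simp only [chainSum]
    rw [Finset.sum_eq_card_nsmul (b := (1 : A)) (fun i _ => by simp)]
    simp [Finset.filter_true_of_mem]
  | cons α αs ih =>
    simp only [chainSum]
    rw [Finset.sum_filter]
    refine Eq.trans ?_
      (Equiv.sum_comp (Fin.consEquiv (fun _ : Fin (αs.length + 1) => Fin w.length)) _)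
    rw [Fintype.sum_prod_type]
    refine Finset.sum_congr rfl fun i _ => ?_
    by_cases hP : P i = true
    · rw [if_pos hP, ih, Finset.sum_filter, Finset.mul_sum]
      refine Finset.sum_congr rfl fun t _ => ?_
      rw [mul_ite, mul_zero]
      refine if_congr ?_ ?_ rfl
      · simp only [List.length_cons, Fin.consEquiv, Equiv.coe_fn_mk]
        constructor
        · rintro ⟨h₁, h₂⟩
          refine ⟨fun a b => ?_, fun a => ?_⟩
          · refine Fin.cases ?_ (fun b' => ?_) b
            · intro h; simp at h
            · refine Fin.cases ?_ (fun a' => ?_) a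
              · intro h
                simpa using h₂ b' (by simpa using h.symm)
              · intro h
                simpa using h₁ a' b' (by simpa using h)
          · refine Fin.cases ?_ (fun a' => ?_) a
            · intro _; simpa using hP
            · intro h; simp at h
        · rintro ⟨h₁, -⟩
          refine ⟨fun a b h => ?_, fun b h => ?_⟩
          · simpa using h₁ a.succ b.succ (by simpa using h)
          · simpa using h₁ 0 b.succ (by simpa using h)
      · exact (Fin.prod_univ_succ (fun j : Fin (αs.length + 1) =>
          sev ((α :: αs).get j) (w.get (Fin.cons (α := fun _ => Fin w.length) i t j)))).symm
    · rw [if_neg hP]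
      refine (Finset.sum_eq_zero fun t _ => if_neg ?_).symm
      rintro ⟨-, h⟩
      exact hP (h ⟨0, Nat.succ_pos _⟩ rfl)

theorem lbnWord_eq_chainSum {A : Type*} [CommRing A] {S : Type*} (w : List (S × Bool))
    (αs : List (S → A)) : lbnWord A w αs = chainSum w αs (fun _ => true) := by
  simp [lbnWord, chainSum_eq_sum_filter]

theorem ltw_cons_succ {S : Type*} (l : S × Bool) (w : List (S × Bool)) (p q : Fin w.length) :
    ltw (l :: w) p.succ q.succ = ltw w p q := by
  simp [ltw]

theorem ltw_cons_succ_zero {S : Type*} (l : S × Bool) (w : List (S × Bool))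
    (p : Fin w.length) : ltw (l :: w) p.succ ⟨0, Nat.succ_pos _⟩ = false := by
  simp [ltw]

theorem chainSum_cons_word {A : Type*} [CommRing A] {S : Type*} (l : S × Bool)
    (w : List (S × Bool)) (αs : List (S → A)) (P : Fin (l :: w).length → Bool)
    (hP : P ⟨0, Nat.succ_pos _⟩ = false) :
    chainSum (l :: w) αs P = chainSum w αs (fun i => P i.succ) := by
  induction αs generalizing P with
  | nil => rfl
  | cons α αs ih =>
    simp only [chainSum]
    refine (Fin.sum_univ_succ (n := w.length) _).trans ?_
    rw [if_neg (by simpa using hP), zero_add]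
    refine Finset.sum_congr rfl fun i _ => ?_
    rw [ih _ (ltw_cons_succ_zero l w i)]
    simp only [ltw_cons_succ]
    rfl

theorem lbnWord_nil {A : Type*} [CommRing A] {S : Type*} (w : List (S × Bool)) :
    lbnWord A w [] = 1 := by
  rw [lbnWord_eq_chainSum]; rfl

theorem lbnWord_cons_cons {A : Type*} [CommRing A] {S : Type*} (l : S × Bool)
    (w : List (S × Bool)) (α : S → A) (αs : List (S → A)) :
    lbnWord A (l :: w) (α :: αs) = lbnWord A w (α :: αs) +
      sev α l * (if l.2 then lbnWord A w αs else lbnWord A (l :: w) αs) := by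
  simp only [lbnWord_eq_chainSum, chainSum, if_true]
  refine (Fin.sum_univ_succ (n := w.length) _).trans ?_
  rw [add_comm]
  congr 1
  · refine Finset.sum_congr rfl fun i _ => ?_
    rw [chainSum_cons_word _ _ _ _ (ltw_cons_succ_zero l w i)]
    simp only [ltw_cons_succ]
    rfl
  · congr 1
    by_cases hl : l.2 = true
    · rw [if_pos hl, chainSum_cons_word _ _ _ _ (by simp [ltw, hl])]
      congr 1
      funext i
      simp [ltw, hl]
    · rw [if_neg hl]
      congr 1
      funext i
      simp [ltw, hl]

theorem lbnWord_cons_congr {A : Type*} [CommRing A] {S : Type*} (l : S × Bool)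
    {u v : List (S × Bool)} (h : lbnWord A u = lbnWord A v) :
    lbnWord A (l :: u) = lbnWord A (l :: v) := by
  funext αs
  induction αs with
  | nil => simp only [lbnWord_nil]
  | cons α αs ih => rw [lbnWord_cons_cons, lbnWord_cons_cons, h, ih]

theorem lbnWord_cancel {A : Type*} [CommRing A] {S : Type*} (s : S) (b : Bool)
    (w : List (S × Bool)) : lbnWord A ((s, b) :: (s, !b) :: w) = lbnWord A w := by
  funext αs
  induction αs with
  | nil => simp only [lbnWord_nil]
  | cons α αs ih =>
    rw [lbnWord_cons_cons, lbnWord_cons_cons, ih]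
    cases b <;> simp [sev]

theorem lbnWord_eq_of_step {A : Type*} [CommRing A] {S : Type*} {u v : List (S × Bool)}
    (h : FreeGroup.Red.Step u v) : lbnWord A u = lbnWord A v := by
  obtain @⟨L₁, L₂, s, b⟩ := h
  induction L₁ with
  | nil => exact lbnWord_cancel s b L₂
  | cons l L₁ ih => exact lbnWord_cons_congr l ih

/-- If two words `u` and `v` represent the same element of the free group `F_S`,
then their letter-braiding numbers agree; in particular `ℓ_{α₁|…|α_r}` is a
well-defined function on `F_S`. -/
theorem letterBraiding_wellDefined (A : Type*) [CommRing A] (S : Type*) [DecidableEq S]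
    (r : ℕ) (hr : 1 ≤ r) (αs : List (S → A)) (hlen : αs.length = r)
    (u v : List (S × Bool)) (huv : FreeGroup.mk u = FreeGroup.mk v) :
    lbnWord A u αs = lbnWord A v αs := by
  exact congrFun (congrArg (Quot.lift (lbnWord A) fun _ _ => lbnWord_eq_of_step) huv) αs
end
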